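/- Let A, Â be symmetric PSD d×d matrices with rank(A) = r, ‖Â − A‖ ≤ ε < σ_r(A)/4, and Â PSD. Let Ŵ = V̂ D̂^{-1/2} where V̂, D̂ are the top-r eigenvectors/eigenvalues of Â. Then ‖I_r − Ŵ^T A Ŵ‖ ≤ 2ε/σ_r(A), and consequently ‖I_r − (Ŵ^T A Ŵ)^{-1/2}‖ ≤ 4ε/σ_r(A). -/

import Mathlib

open Matrix

/-- The spectral norm of a real matrix. -/
noncomputable def spec {d : ℕ} (A : Matrix (Fin d) (Fin d) ℝ) : ℝ :=
  ‖Matrix.toEuclideanCLM (𝕜 := ℝ) A‖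

/-- The `j`-th (0-indexed) largest eigenvalue of a symmetric real matrix. -/
noncomputable def topEig {d : ℕ} (A : Matrix (Fin d) (Fin d) ℝ)
    (hA : A.IsHermitian) (j : ℕ) : ℝ :=
  ((List.ofFn hA.eigenvalues).insertionSort (· ≥ ·)).getD j 0

open scoped Matrix.Norms.L2Operator in
theorem l2_opNorm_one_le (n : ℕ) : ‖(1 : Matrix (Fin n) (Fin n) ℝ)‖ ≤ 1 := by
  rw [← diagonal_one, l2_opNorm_diagonal]
  exact pi_norm_le_iff_of_nonneg zero_le_one |>.mpr fun i => by simp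

theorem topEig_eq_eigenvalues_perm {d : ℕ} (A : Matrix (Fin d) (Fin d) ℝ) (hA : A.IsHermitian) :
    ∃ σ : Equiv.Perm (Fin d), Antitone (hA.eigenvalues ∘ σ) ∧
      ∀ k : Fin d, topEig A hA k = hA.eigenvalues (σ k) := by
  obtain ⟨σ, hσ⟩ : ∃ σ : Equiv.Perm (Fin d), Antitone (hA.eigenvalues ∘ σ) :=
    ⟨Tuple.sort (OrderDual.toDual ∘ hA.eigenvalues),
      Tuple.monotone_sort (OrderDual.toDual ∘ hA.eigenvalues)⟩
  refine ⟨σ, hσ, fun k => ?_⟩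
  have hsort : (List.ofFn hA.eigenvalues).insertionSort (· ≥ ·)
      = List.ofFn (hA.eigenvalues ∘ σ) :=
    ((List.perm_insertionSort _ _).trans (Equiv.Perm.ofFn_comp_perm σ _).symm).eq_of_pairwise'
      (List.pairwise_insertionSort _ _) hσ.sortedGE_ofFn.pairwise
  simp [topEig, hsort]

theorem inner_toEuclideanCLM_eq_sum {d : ℕ} (A : Matrix (Fin d) (Fin d) ℝ) (hA : A.IsHermitian)
    (x : EuclideanSpace ℝ (Fin d)) :
    inner ℝ x (toEuclideanCLM (𝕜 := ℝ) A x)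
      = ∑ i, hA.eigenvalues i * inner ℝ (hA.eigenvectorBasis i) x ^ 2 := by
  have hsymm : (toEuclideanLin A).IsSymmetric := isSymmetric_toEuclideanLin_iff.mpr hA
  rw [← hA.eigenvectorBasis.sum_inner_mul_inner]
  refine Finset.sum_congr rfl fun i _ => ?_
  have heig : toEuclideanLin A (hA.eigenvectorBasis i)
      = hA.eigenvalues i • hA.eigenvectorBasis i := by
    ext j
    simpa using congrFun (hA.mulVec_eigenvectorBasis i) j
  have h := hsymm (hA.eigenvectorBasis i) x
  rw [heig, real_inner_smul_left] at h
  rw [real_inner_comm]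
  change _ * inner ℝ _ (toEuclideanLin A x) = _
  rw [← h]
  ring

/-- **Weyl's inequality** for symmetric real matrices. -/
theorem topEig_le_topEig_add_spec {d : ℕ} (A B : Matrix (Fin d) (Fin d) ℝ)
    (hA : A.IsHermitian) (hB : B.IsHermitian) (k : Fin d) :
    topEig A hA k ≤ topEig B hB k + spec (A - B) := by
  obtain ⟨σ, hσ, hσk⟩ := topEig_eq_eigenvalues_perm A hA
  obtain ⟨τ, hτ, hτk⟩ := topEig_eq_eigenvalues_perm B hB
  rw [hσk, hτk]
  let f : {i : Fin d // i ≠ k} → EuclideanSpace ℝ (Fin d) := fun i =>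
    if k < i then hA.eigenvectorBasis (σ i) else hB.eigenvectorBasis (τ i)
  let L : EuclideanSpace ℝ (Fin d) →ₗ[ℝ] ({i : Fin d // i ≠ k} → ℝ) :=
    LinearMap.pi fun i => (innerSL ℝ (f i)).toLinearMap
  have hker : LinearMap.ker L ≠ ⊥ := by
    apply LinearMap.ker_ne_bot_of_finrank_lt
    have := k.pos
    simp [Fintype.card_subtype_compl]
    omega
  obtain ⟨x, hx, hx0⟩ := Submodule.exists_mem_ne_zero_of_ne_bot hker
  have hfx : ∀ i, inner ℝ (f i) x = 0 := fun i => congrFun (LinearMap.mem_ker.mp hx) i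
  have hAx : hA.eigenvalues (σ k) * ‖x‖ ^ 2 ≤ inner ℝ x (toEuclideanCLM (𝕜 := ℝ) A x) := by
    rw [inner_toEuclideanCLM_eq_sum A hA, ← hA.eigenvectorBasis.sum_sq_inner_right x,
      Finset.mul_sum]
    refine (Equiv.sum_comp σ _).symm.trans_le <|
      (Finset.sum_le_sum fun i _ => ?_).trans_eq (Equiv.sum_comp σ _)
    by_cases hi : k < i
    · have h := hfx ⟨i, hi.ne'⟩
      simp only [f, if_pos hi] at h
      simp [h]
    · exact mul_le_mul_of_nonneg_right (hσ (not_lt.mp hi)) (sq_nonneg _)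
  have hBx : inner ℝ x (toEuclideanCLM (𝕜 := ℝ) B x) ≤ hB.eigenvalues (τ k) * ‖x‖ ^ 2 := by
    rw [inner_toEuclideanCLM_eq_sum B hB, ← hB.eigenvectorBasis.sum_sq_inner_right x,
      Finset.mul_sum]
    refine (Equiv.sum_comp τ _).symm.trans_le <|
      (Finset.sum_le_sum fun i _ => ?_).trans_eq (Equiv.sum_comp τ _)
    by_cases hi : i < k
    · have h := hfx ⟨i, hi.ne⟩
      simp only [f, if_neg hi.not_gt] at h
      simp [h]
    · exact mul_le_mul_of_nonneg_right (hτ (not_lt.mp hi)) (sq_nonneg _)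
  have hAB : inner ℝ x (toEuclideanCLM (𝕜 := ℝ) A x) - inner ℝ x (toEuclideanCLM (𝕜 := ℝ) B x)
      ≤ spec (A - B) * ‖x‖ ^ 2 := by
    rw [← inner_sub_right, ← _root_.sub_apply, ← map_sub]
    calc _ ≤ ‖x‖ * ‖toEuclideanCLM (𝕜 := ℝ) (A - B) x‖ := real_inner_le_norm _ _
      _ ≤ ‖x‖ * (spec (A - B) * ‖x‖) := by
        gcongr
        exact ContinuousLinearMap.le_opNorm _ _
      _ = _ := by ring
  have hx2 : 0 < ‖x‖ ^ 2 := by positivity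
  nlinarith

theorem norm_le_norm_one_add_posSemidef {n : ℕ} {S : Matrix (Fin n) (Fin n) ℝ}
    (hS : S.PosSemidef) (x : EuclideanSpace ℝ (Fin n)) :
    ‖x‖ ≤ ‖toEuclideanCLM (𝕜 := ℝ) (1 + S) x‖ := by
  have hSx : 0 ≤ inner ℝ x (toEuclideanCLM (𝕜 := ℝ) S x) := by
    rw [inner_toEuclideanCLM]
    simpa using hS.dotProduct_mulVec_nonneg x.ofLp
  have h : ‖x‖ * ‖x‖ ≤ ‖x‖ * ‖toEuclideanCLM (𝕜 := ℝ) (1 + S) x‖ := by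
    refine le_trans ?_ (real_inner_le_norm _ _)
    rw [map_add, map_one, _root_.add_apply, inner_add_right,
      one_apply_eq_self, real_inner_self_eq_norm_mul_norm]
    linarith
  rcases (norm_nonneg x).eq_or_lt with h0 | h0
  · rw [← h0]
    exact norm_nonneg _
  · exact le_of_mul_le_mul_left h h0

theorem spec_one_sub_le_spec_one_sub_mul_self {n : ℕ} {S : Matrix (Fin n) (Fin n) ℝ}
    (hS : S.PosSemidef) : spec (1 - S) ≤ spec (1 - S * S) := by
  refine ContinuousLinearMap.opNorm_le_bound _ (norm_nonneg _) fun x => ?_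
  refine (norm_le_norm_one_add_posSemidef hS _).trans ?_
  rw [← mul_apply_eq_comp, ← map_mul,
    show (1 + S) * (1 - S) = 1 - S * S by noncomm_ring]
  exact ContinuousLinearMap.le_opNorm _ _

open scoped Matrix.Norms.L2Operator in
/-- If `S` is an inverse square root of `M`, then it is close to `1` when `M` is. -/
theorem spec_one_sub_inv_sqrt_le {n : ℕ} {S M : Matrix (Fin n) (Fin n) ℝ}
    (hS : S.PosSemidef) (hSM : S * S * M = 1) {δ : ℝ} (hM : spec (1 - M) ≤ δ) (hδ : δ < 1) :
    spec (1 - S) ≤ δ / (1 - δ) := by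
  refine (spec_one_sub_le_spec_one_sub_mul_self hS).trans ?_
  rw [le_div_iff₀ (by linarith)]
  change ‖1 - S * S‖ * (1 - δ) ≤ δ
  change ‖1 - M‖ ≤ δ at hM
  have hδ0 : 0 ≤ δ := (norm_nonneg _).trans hM
  have h1 := l2_opNorm_one_le n
  have hfac : 1 - S * S = (1 - (1 - S * S)) * -(1 - M) := by
    rw [sub_sub_cancel, neg_sub, mul_sub, hSM, mul_one]
  have hle : ‖1 - S * S‖ ≤ (1 + ‖1 - S * S‖) * δ := by
    calc ‖1 - S * S‖ = ‖(1 - (1 - S * S)) * -(1 - M)‖ := congrArg _ hfac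
      _ ≤ ‖1 - (1 - S * S)‖ * ‖-(1 - M)‖ := norm_mul_le _ _
      _ ≤ (1 + ‖1 - S * S‖) * δ := by
        rw [norm_neg]
        gcongr
        exact (norm_sub_le _ _).trans (by gcongr)
  linarith

open scoped Matrix.Norms.L2Operator in
/-- Whitening `A` by the whitening matrix of a nearby `B` gives a matrix close to `1`. -/
theorem spec_one_sub_whiten_le {d r : ℕ} (A B : Matrix (Fin d) (Fin d) ℝ)
    (V : Matrix (Fin d) (Fin r) ℝ) (b : Fin r → ℝ) (hV : Vᵀ * V = 1)
    (hBV : B * V = V * diagonal b) {m : ℝ} (hm : 0 < m) (hb : ∀ j, m ≤ b j) :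
    spec ((1 : Matrix (Fin r) (Fin r) ℝ)
        - (V * diagonal fun j => (Real.sqrt (b j))⁻¹)ᵀ * A
          * (V * diagonal fun j => (Real.sqrt (b j))⁻¹))
      ≤ spec (A - B) / m := by
  set D : Matrix (Fin r) (Fin r) ℝ := diagonal fun j => (Real.sqrt (b j))⁻¹ with hD
  have hWB : (V * D)ᵀ * B * (V * D) = 1 := by
    have hT : Dᵀ = D := diagonal_transpose _
    calc (V * D)ᵀ * B * (V * D) = D * (Vᵀ * (B * V)) * D := by
          rw [transpose_mul, hT]
          simp only [Matrix.mul_assoc]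
      _ = D * diagonal b * D := by rw [hBV, ← Matrix.mul_assoc Vᵀ, hV, Matrix.one_mul]
      _ = 1 := by
        rw [hD, diagonal_mul_diagonal, diagonal_mul_diagonal, ← diagonal_one]
        congr 1
        ext j
        have hj : 0 < b j := hm.trans_le (hb j)
        have hs : Real.sqrt (b j) ≠ 0 := (Real.sqrt_pos.mpr hj).ne'
        field_simp
        rw [Real.sq_sqrt hj.le]
  have hVn : ‖V‖ ≤ 1 := by
    have h1 := l2_opNorm_one_le r
    have h := l2_opNorm_conjTranspose_mul_self V
    rw [conjTranspose_eq_transpose_of_trivial, hV] at h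
    nlinarith [norm_nonneg V]
  have hDn : ‖D‖ ≤ (Real.sqrt m)⁻¹ := by
    rw [hD, l2_opNorm_diagonal]
    refine (pi_norm_le_iff_of_nonneg (by positivity)).mpr fun j => ?_
    rw [Real.norm_of_nonneg (by positivity)]
    exact inv_anti₀ (Real.sqrt_pos.mpr hm) (Real.sqrt_le_sqrt (hb j))
  have hWn : ‖V * D‖ ≤ (Real.sqrt m)⁻¹ :=
    (l2_opNorm_mul V D).trans <| (mul_le_mul hVn hDn (norm_nonneg _) zero_le_one).trans_eq
      (one_mul _)
  have hWT : ‖(V * D)ᵀ‖ ≤ (Real.sqrt m)⁻¹ := by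
    rwa [← conjTranspose_eq_transpose_of_trivial, l2_opNorm_conjTranspose]
  change ‖1 - (V * D)ᵀ * A * (V * D)‖ ≤ ‖A - B‖ / m
  have hdiff : 1 - (V * D)ᵀ * A * (V * D) = -((V * D)ᵀ * (A - B) * (V * D)) := by
    rw [Matrix.mul_sub, Matrix.sub_mul, hWB, neg_sub]
  rw [hdiff, norm_neg]
  calc _ ≤ ‖(V * D)ᵀ * (A - B)‖ * ‖V * D‖ := l2_opNorm_mul _ _
    _ ≤ ‖(V * D)ᵀ‖ * ‖A - B‖ * ‖V * D‖ := by
      gcongr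
      exact l2_opNorm_mul _ _
    _ ≤ (Real.sqrt m)⁻¹ * ‖A - B‖ * (Real.sqrt m)⁻¹ := by gcongr
    _ = ‖A - B‖ / (Real.sqrt m * Real.sqrt m) := by field_simp
    _ = ‖A - B‖ / m := by rw [Real.mul_self_sqrt hm.le]

/-- With `Ŵ = V̂ D̂^(-1/2)` built from the top-`r` eigenpairs of `Â`, if `A` is PSD of
rank `r` and `‖A - Â‖ ≤ ε < σ_r(A)/4`, then `‖I - Ŵᵀ A Ŵ‖ ≤ 2ε/σ_r(A)` and
`‖I - (Ŵᵀ A Ŵ)^(-1/2)‖ ≤ 4ε/σ_r(A)` (where `S = (Ŵᵀ A Ŵ)^(-1/2)` is the unique PSD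
matrix with `S S (Ŵᵀ A Ŵ) = I`). -/
theorem stmt18 {d r : ℕ} (hr : 0 < r) (ε : ℝ) (hε : 0 < ε)
    (A Ahat : Matrix (Fin d) (Fin d) ℝ) (hA : A.PosSemidef) (hAhat : Ahat.PosSemidef)
    (hrank : A.rank = r)
    (Vhat : Matrix (Fin d) (Fin r) ℝ) (dhat : Fin r → ℝ)
    (hVhat : Vhatᵀ * Vhat = 1) (heig : Ahat * Vhat = Vhat * Matrix.diagonal dhat)
    (htop : ∀ j, topEig Ahat hAhat.1 (r - 1) ≤ dhat j)
    (hclose : spec (A - Ahat) ≤ ε) (hεσ : ε < topEig A hA.1 (r - 1) / 4) :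
    spec ((1 : Matrix (Fin r) (Fin r) ℝ)
        - (Vhat * Matrix.diagonal fun j => (Real.sqrt (dhat j))⁻¹)ᵀ * A
          * (Vhat * Matrix.diagonal fun j => (Real.sqrt (dhat j))⁻¹))
      ≤ 2 * ε / topEig A hA.1 (r - 1) ∧
    ∀ S : Matrix (Fin r) (Fin r) ℝ, S.PosSemidef →
      S * S * ((Vhat * Matrix.diagonal fun j => (Real.sqrt (dhat j))⁻¹)ᵀ * A
          * (Vhat * Matrix.diagonal fun j => (Real.sqrt (dhat j))⁻¹)) = 1 →
      spec (1 - S) ≤ 4 * ε / topEig A hA.1 (r - 1) := by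
  set σ := topEig A hA.1 (r - 1)
  have hσ : 0 < σ := by linarith
  have hrd : r ≤ d := hrank ▸ A.rank_le_card_width.trans_eq (Fintype.card_fin d)
  have hweyl := topEig_le_topEig_add_spec A Ahat hA.1 hAhat.1 ⟨r - 1, by omega⟩
  have hdhat : ∀ j, 3 / 4 * σ ≤ dhat j := fun j => by linarith [htop j]
  have hwhiten := (spec_one_sub_whiten_le A Ahat Vhat dhat hVhat heig
    (by positivity) hdhat).trans (div_le_div_of_nonneg_right hclose (by positivity))
  have hδ : ε / (3 / 4 * σ) < 1 / 3 := by
    rw [div_lt_iff₀ (by positivity)]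
    linarith
  have hδσ : 3 / 2 * (ε / (3 / 4 * σ)) = 2 * ε / σ := by field_simp; norm_num
  have hδ0 : 0 ≤ ε / (3 / 4 * σ) := by positivity
  refine ⟨by linarith, fun S hS hSM => ?_⟩
  refine (spec_one_sub_inv_sqrt_le hS hSM hwhiten (by linarith)).trans ?_
  have h4 : 4 * ε / σ = 2 * (2 * ε / σ) := by ring
  rw [h4, ← hδσ, div_le_iff₀ (by linarith)]
  nlinarith
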